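/- arXiv:2507.15123 — 3 statements merged into one kernel-verified Lean document; each statement's English description precedes it below -/
import Mathlib

section
/- (Hindman's theorem, union form) For every coloring c : FIN → {0,1} there exists an infinite block sequence X ∈ FIN^[∞] such that c is constant on [X]. -/
/-- `blockLt s t` means every element of `s` is below every element of `t`
(for nonempty finite sets this is `max s < min t`). -/
def blockLt (s t : Finset ℕ) : Prop := ∀ a ∈ s, ∀ b ∈ t, a < b

/-- An infinite block sequence: a sequence of nonempty finite sets of naturals,
each block entirely below the next. -/
def IsBlockSeq (X : ℕ → Finset ℕ) : Prop :=
  ∀ i, (X i).Nonempty ∧ blockLt (X i) (X (i + 1))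

/-- A finite block sequence of length `n`. -/
def IsFinBlockSeq {n : ℕ} (a : Fin n → Finset ℕ) : Prop :=
  (∀ i, (a i).Nonempty) ∧ ∀ i j : Fin n, i < j → blockLt (a i) (a j)

/-- `s ∈ [X]`: `s` is the union of the blocks `X i` for `i` in some nonempty finite set. -/
def InUnions (X : ℕ → Finset ℕ) (s : Finset ℕ) : Prop :=
  ∃ I : Finset ℕ, I.Nonempty ∧ s = I.biUnion X

/-- `Y ≤ X`: `Y` is a condensation of `X`, i.e. every block of `Y` is in `[X]`. -/
def Condensation (Y X : ℕ → Finset ℕ) : Prop := ∀ n, InUnions X (Y n)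

/-- `Y ≤* X`: some tail of `Y` (all blocks whose elements exceed some `m`)
is a condensation of `X`. -/
def CondensationStar (Y X : ℕ → Finset ℕ) : Prop :=
  ∃ m : ℕ, ∀ i, (∀ a ∈ Y i, m < a) → InUnions X (Y i)

/-- A nonempty family `H ⊆ FIN^[∞]` is Matet-adequate. -/
def MatetAdequate (H : Set (ℕ → Finset ℕ)) : Prop :=
  H.Nonempty ∧
  (∀ X ∈ H, IsBlockSeq X) ∧
  -- (i) closed under finite changes
  (∀ Y ∈ H, ∀ X : ℕ → Finset ℕ, IsBlockSeq X → {n | X n ≠ Y n}.Finite → X ∈ H) ∧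
  -- (ii) closed ≤*-upwards
  (∀ Y ∈ H, ∀ X : ℕ → Finset ℕ, IsBlockSeq X → CondensationStar Y X → X ∈ H) ∧
  -- (iii) ≤-descending sequences have ≤*-lower bounds in H
  (∀ f : ℕ → ℕ → Finset ℕ, (∀ n, f n ∈ H) → (∀ n, Condensation (f (n + 1)) (f n)) →
    ∃ X ∈ H, ∀ n, CondensationStar X (f n)) ∧
  -- (iv) Hindman property relative to H
  (∀ X ∈ H, ∀ c : Finset ℕ → Fin 2, ∃ Y ∈ H, Condensation Y X ∧
    ∃ j : Fin 2, ∀ s : Finset ℕ, InUnions Y s → c s = j)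

open Filter

/-- The semigroup of finite sets of naturals under union, written additively. -/
abbrev unionAddSemigroup : AddSemigroup (Finset ℕ) where
  add s t := s ∪ t
  add_assoc := Finset.union_assoc

section

attribute [local instance] unionAddSemigroup Ultrafilter.addSemigroup

/-- There is an ultrafilter on finite sets, idempotent for union, which contains the collection of
nonempty sets lying above `n`, for every `n`. -/
theorem exists_union_idempotent_ultrafilter :
    ∃ U : Ultrafilter (Finset ℕ),
      (∀ A ∈ U, ∀ᶠ s in (U : Filter (Finset ℕ)), ∀ᶠ t in (U : Filter (Finset ℕ)), s ∪ t ∈ A) ∧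
      ∀ n, ∀ᶠ s in (U : Filter (Finset ℕ)), s.Nonempty ∧ ∀ a ∈ s, n < a := by
  let T : ℕ → Set (Finset ℕ) := fun n => {s | s.Nonempty ∧ ∀ a ∈ s, n < a}
  let S : Set (Ultrafilter (Finset ℕ)) := ⋂ n, {U | T n ∈ U}
  have hclosed : IsClosed S := isClosed_iInter fun n => ultrafilter_isClosed_basic (T n)
  have hne : S.Nonempty := by
    apply IsCompact.nonempty_iInter_of_sequence_nonempty_isCompact_isClosed
    · intro n U hU
      exact mem_of_superset hU fun s hs => ⟨hs.1, fun a ha => (Nat.lt_succ_self n).trans (hs.2 a ha)⟩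
    · exact fun n => ⟨pure {n + 1}, mem_pure.mpr (by simp [T])⟩
    · exact (ultrafilter_isClosed_basic _).isCompact
    · exact fun n => ultrafilter_isClosed_basic _
  obtain ⟨U, hU, hidem⟩ := exists_idempotent_in_compact_add_subsemigroup
    Ultrafilter.continuous_add_left S hne hclosed.isCompact (by
      intro U hU V hV
      rw [Set.mem_iInter] at *
      intro n
      change ∀ᶠ s in ↑(U + V), s ∈ T n
      rw [Ultrafilter.eventually_add]
      filter_upwards [hU n] with s hs
      filter_upwards [hV n] with t ht
      refine ⟨hs.1.mono Finset.subset_union_left, fun a ha => ?_⟩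
      exact (Finset.mem_union.mp ha).elim (hs.2 a) (ht.2 a))
  refine ⟨U, fun A hA => ?_, fun n => Set.mem_iInter.mp hU n⟩
  rw [← hidem] at hA
  exact (Ultrafilter.eventually_add U U (· ∈ A)).mp hA

end

/-- If `B (n + 1) ⊆ B n`, `X n ∈ B n` and `X n ∪ t ∈ B n` for all `t ∈ B (n + 1)`, then all unions
of blocks of `X` with indices at least `n` are in `B n`. -/
theorem biUnion_mem_of_antitone {X : ℕ → Finset ℕ} {B : ℕ → Set (Finset ℕ)} (hB : Antitone B)
    (hX : ∀ n, X n ∈ B n) (hunion : ∀ n, ∀ t ∈ B (n + 1), X n ∪ t ∈ B n) (I : Finset ℕ) :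
    ∀ n, I.Nonempty → (∀ i ∈ I, n ≤ i) → I.biUnion X ∈ B n := by
  induction I using Finset.induction_on_min with
  | empty => simp
  | insert m J hm ih =>
    intro n _ hn
    apply hB (hn m (Finset.mem_insert_self m J))
    rw [Finset.biUnion_insert]
    rcases J.eq_empty_or_nonempty with rfl | hJ
    · simpa using hX m
    · exact hunion m _ (ih (m + 1) hJ hm)

/-- Hindman's theorem, union form. -/
theorem hindman_union (c : Finset ℕ → Fin 2) :
    ∃ X : ℕ → Finset ℕ, IsBlockSeq X ∧
      ∃ j : Fin 2, ∀ s : Finset ℕ, InUnions X s → c s = j := by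
  obtain ⟨U, hidem, hlarge⟩ := exists_union_idempotent_ultrafilter
  obtain ⟨j, hj⟩ : ∃ j, {s | c s = j} ∈ U := by
    by_contra! h
    have h' := fun j => Ultrafilter.compl_mem_iff_notMem.mpr (h j)
    obtain ⟨s, hs⟩ := Ultrafilter.nonempty_of_mem (iInter_mem.mpr h')
    exact Set.mem_iInter.mp hs (c s) rfl
  have hstep : ∀ B : {B : Set (Finset ℕ) // B ∈ U}, ∃ x ∈ B.1,
      ∃ C : {C : Set (Finset ℕ) // C ∈ U}, C.1 ⊆ B.1 ∧ ∀ t ∈ C.1, x ∪ t ∈ B.1 ∧ blockLt x t := by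
    rintro ⟨B, hB⟩
    obtain ⟨x, hxB, hx⟩ := Ultrafilter.nonempty_of_mem (inter_mem hB (hidem B hB))
    refine ⟨x, hxB, ⟨B ∩ ({t | x ∪ t ∈ B} ∩ _), inter_mem hB (inter_mem hx (hlarge (x.sup id)))⟩,
      Set.inter_subset_left, ?_⟩
    rintro t ⟨-, ht, ht'⟩
    exact ⟨ht, fun a ha b hb => (Finset.le_sup (f := id) ha).trans_lt (ht'.2 b hb)⟩
  choose x hx next hnext hunion using hstep
  let B : ℕ → {B : Set (Finset ℕ) // B ∈ U} :=
    fun n => next^[n] ⟨{s | c s = j} ∩ _, inter_mem hj (hlarge 0)⟩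
  have hsucc : ∀ n, B (n + 1) = next (B n) := fun n => Function.iterate_succ_apply' _ _ _
  have hanti : Antitone fun n => (B n).1 :=
    antitone_nat_of_succ_le fun n => by rw [hsucc]; exact hnext _
  have hmem : ∀ n, x (B n) ∈ (B n).1 := fun n => hx _
  have hnextB : ∀ n, ∀ t ∈ (B (n + 1)).1, x (B n) ∪ t ∈ (B n).1 ∧ blockLt (x (B n)) t := by
    intro n
    rw [hsucc]
    exact hunion _
  refine ⟨fun n => x (B n), fun n => ⟨?_, (hnextB n _ (hmem (n + 1))).2⟩, j, ?_⟩
  · exact (hanti (Nat.zero_le n) (hmem n)).2.1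
  · rintro s ⟨I, hI, rfl⟩
    exact (biUnion_mem_of_antitone hanti hmem (fun n t ht => (hnextB n t ht).1) I 0 hI
      fun i _ => Nat.zero_le i).1
end

section
/- If H ⊆ FIN^[∞] is a Matet-adequate family, then for every positive integer n, every X ∈ H, and every coloring c : [X]^[n] → {0,1}, there exists Y ∈ H with Y ≤ X such that c is constant on [Y]^[n]. -/
theorem InUnions.of_forall_mem {X Y : ℕ → Finset ℕ} {I : Finset ℕ} (hI : I.Nonempty)
    (h : ∀ i ∈ I, InUnions X (Y i)) : InUnions X (I.biUnion Y) := by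
  classical
  choose! J hJ hY using h
  refine ⟨I.biUnion J, hI.biUnion hJ, ?_⟩
  rw [Finset.biUnion_biUnion]
  exact Finset.biUnion_congr rfl hY

theorem InUnions.mono {X Y : ℕ → Finset ℕ} (h : Condensation Y X) {s : Finset ℕ}
    (hs : InUnions Y s) : InUnions X s := by
  obtain ⟨I, hI, rfl⟩ := hs
  exact InUnions.of_forall_mem hI fun i _ => h i

theorem inUnions_self (X : ℕ → Finset ℕ) (i : ℕ) : InUnions X (X i) :=
  ⟨{i}, by simp, by simp⟩

theorem InUnions.union {X : ℕ → Finset ℕ} {s t : Finset ℕ} (hs : InUnions X s)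
    (ht : InUnions X t) : InUnions X (s ∪ t) := by
  obtain ⟨I, hI, rfl⟩ := hs
  obtain ⟨J, hJ, rfl⟩ := ht
  exact ⟨I ∪ J, hI.mono Finset.subset_union_left, Finset.union_biUnion.symm⟩

theorem InUnions.nonempty {X : ℕ → Finset ℕ} (hX : IsBlockSeq X) {s : Finset ℕ}
    (hs : InUnions X s) : s.Nonempty := by
  obtain ⟨I, hI, rfl⟩ := hs
  exact hI.biUnion fun i _ => (hX i).1

theorem Condensation.trans {X Y Z : ℕ → Finset ℕ} (h₁ : Condensation Z Y)
    (h₂ : Condensation Y X) : Condensation Z X := fun n => (h₁ n).mono h₂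

theorem IsBlockSeq.le_of_mem {X : ℕ → Finset ℕ} (hX : IsBlockSeq X) (i : ℕ) :
    ∀ b ∈ X i, i ≤ b := by
  induction i with
  | zero => simp
  | succ i ih =>
    intro b hb
    obtain ⟨a, ha⟩ := (hX i).1
    exact (ih a ha).trans_lt ((hX i).2 a ha b hb)

theorem le_sup_id {s : Finset ℕ} {a : ℕ} (ha : a ∈ s) : a ≤ s.sup id :=
  Finset.le_sup (f := id) ha

theorem sup_id_mem {s : Finset ℕ} (hs : s.Nonempty) : s.sup id ∈ s := by
  obtain ⟨a, ha, h⟩ := s.exists_mem_eq_sup hs id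
  exact h ▸ ha

/-- The non-maximal elements `a` of `s` whose successor in `s` is greater than `f a`. -/
def gapSet (f : ℕ → ℕ) (s : Finset ℕ) : Finset ℕ :=
  {a ∈ s | (∃ b ∈ s, a < b) ∧ ∀ b ∈ s, a < b → f a < b}

theorem gapSet_union (f : ℕ → ℕ) {s t : Finset ℕ} (hs : s.Nonempty) (ht : t.Nonempty)
    (hst : blockLt s t) :
    gapSet f (s ∪ t) =
      (gapSet f s ∪ gapSet f t) ∪ {a ∈ ({s.sup id} : Finset ℕ) | ∀ b ∈ t, f a < b} := by
  obtain ⟨b₀, hb₀⟩ := ht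
  have hm := sup_id_mem hs
  have hle : ∀ a ∈ s, a ≤ s.sup id := fun a ha => le_sup_id ha
  generalize s.sup id = m at hm hle
  ext a
  simp only [gapSet, Finset.mem_filter, Finset.mem_union, Finset.mem_singleton]
  constructor
  · rintro ⟨ha | ha, ⟨b₁, hb₁, hab₁⟩, h⟩
    · rcases (hle a ha).lt_or_eq with hlt | rfl
      · exact .inl (.inl ⟨ha, ⟨m, hm, hlt⟩, fun b hb => h b (.inl hb)⟩)
      · exact .inr ⟨rfl, fun b hb => h b (.inr hb) (hst a ha b hb)⟩
    · have hb₁t : b₁ ∈ t := hb₁.resolve_left fun hb => (hst b₁ hb a ha).not_gt hab₁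
      exact .inl (.inr ⟨ha, ⟨b₁, hb₁t, hab₁⟩, fun b hb => h b (.inr hb)⟩)
  · rintro ((⟨ha, ⟨b, hb, hab⟩, h⟩ | ⟨ha, ⟨b, hb, hab⟩, h⟩) | ⟨rfl, h⟩)
    · refine ⟨.inl ha, ⟨b, .inl hb, hab⟩, ?_⟩
      rintro d (hd | hd) had
      · exact h d hd had
      · exact (h b hb hab).trans (hst b hb d hd)
    · refine ⟨.inr ha, ⟨b, .inr hb, hab⟩, ?_⟩
      rintro d (hd | hd) had
      · exact absurd (hst d hd a ha) had.not_gt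
      · exact h d hd had
    · refine ⟨.inl hm, ⟨b₀, .inr hb₀, hst a hm b₀ hb₀⟩, ?_⟩
      rintro d (hd | hd) had
      · exact absurd (hle d hd) had.not_ge
      · exact h d hd

theorem card_gapSet_union (f : ℕ → ℕ) {s t : Finset ℕ} (hs : s.Nonempty) (ht : t.Nonempty)
    (hst : blockLt s t) :
    (gapSet f (s ∪ t)).card = (gapSet f s).card + (gapSet f t).card +
      if ∀ b ∈ t, f (s.sup id) < b then 1 else 0 := by
  have hm := sup_id_mem hs
  rw [gapSet_union f hs ht hst, Finset.card_union_of_disjoint, Finset.card_union_of_disjoint,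
    Finset.filter_singleton]
  · split_ifs <;> simp
  · refine Finset.disjoint_left.2 fun a ha hb => ?_
    exact (hst a (Finset.mem_filter.1 ha).1 a (Finset.mem_filter.1 hb).1).false
  · refine Finset.disjoint_left.2 fun a ha hb => ?_
    obtain rfl := Finset.mem_singleton.1 (Finset.mem_filter.1 hb).1
    rcases Finset.mem_union.1 ha with h | h
    · obtain ⟨-, ⟨b, hb, hlt⟩, -⟩ := Finset.mem_filter.1 h
      exact (le_sup_id hb).not_gt hlt
    · exact (hst _ hm _ (Finset.mem_filter.1 h).1).false

/-- Below every member of a Matet-adequate family there is a member whose unions are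
separated by gaps growing as fast as any prescribed function. -/
theorem MatetAdequate.exists_gap {H : Set (ℕ → Finset ℕ)} (hH : MatetAdequate H)
    {X : ℕ → Finset ℕ} (hX : X ∈ H) (f : ℕ → ℕ) :
    ∃ Y ∈ H, Condensation Y X ∧ ∀ s t, InUnions Y s → InUnions Y t → blockLt s t →
      ∀ b ∈ t, f (s.sup id) < b := by
  obtain ⟨-, hblock, -, -, -, hindman⟩ := hH
  obtain ⟨Y, hY, hYX, j, hj⟩ :=
    hindman X hX fun s => if Even (gapSet f s).card then 0 else 1
  refine ⟨Y, hY, hYX, ?_⟩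
  have hYb := hblock Y hY
  have hparity : ∀ s t, InUnions Y s → InUnions Y t →
      (Even (gapSet f s).card ↔ Even (gapSet f t).card) := by
    intro s t hs ht
    have h := (hj s hs).trans (hj t ht).symm
    by_cases h₁ : Even (gapSet f s).card <;> by_cases h₂ : Even (gapSet f t).card <;>
      simp [h₁, h₂] at h ⊢
  by_contra! hcon
  obtain ⟨s, t, hs, ht, hst, b, hb, hbf⟩ := hcon
  have heven : Even (gapSet f s).card := by
    have h := card_gapSet_union f (hs.nonempty hYb) (ht.nonempty hYb) hst
    rw [if_neg fun h' => (h' b hb).not_ge hbf] at h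
    have h₁ := hparity _ _ (hs.union ht) hs
    have h₂ := hparity _ _ ht hs
    rw [h, add_zero, Nat.even_add] at h₁
    tauto
  obtain ⟨n, hn⟩ : ∃ n, n = max ((Y 0).sup id) (f ((Y 0).sup id)) + 1 := ⟨_, rfl⟩
  have hfar : ∀ b ∈ Y n, (Y 0).sup id < b ∧ f ((Y 0).sup id) < b := by
    intro b hb
    have := hYb.le_of_mem n b hb
    omega
  have h := card_gapSet_union f (hYb 0).1 (hYb n).1
    fun a ha b hb => (le_sup_id ha).trans_lt (hfar b hb).1
  rw [if_pos fun b hb => (hfar b hb).2] at h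
  have h₀ := (hparity _ _ hs (inUnions_self Y 0)).1 heven
  have h₁ := (hparity _ _ hs (inUnions_self Y n)).1 heven
  have h₂ := (hparity _ _ hs ((inUnions_self Y 0).union (inUnions_self Y n))).1 heven
  rw [h] at h₂
  exact Nat.not_even_iff_odd.2 (h₀.add h₁).add_one h₂

/-- An almost condensation can be truncated to a condensation inside a Matet-adequate family. -/
theorem MatetAdequate.exists_tail {H : Set (ℕ → Finset ℕ)} (hH : MatetAdequate H)
    {X Z : ℕ → Finset ℕ} (hZ : Z ∈ H) (hZX : CondensationStar Z X) :
    ∃ W ∈ H, Condensation W X ∧ Condensation W Z := by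
  obtain ⟨-, hblock, -, hup, -, -⟩ := hH
  have hZb := hblock Z hZ
  obtain ⟨m, hm⟩ := hZX
  refine ⟨fun n => Z (n + (m + 1)), hup Z hZ _ (fun i => ?_) ?_, fun n => hm _ fun a ha => ?_,
    fun n => inUnions_self Z _⟩
  · have := hZb (i + (m + 1))
    rwa [show i + (m + 1) + 1 = i + 1 + (m + 1) by omega] at this
  · refine ⟨(Finset.range (m + 1)).sup fun i => (Z i).sup id, fun i hi => ?_⟩
    by_cases him : i < m + 1
    · obtain ⟨a, ha⟩ := (hZb i).1
      have h₁ : (Z i).sup id ≤ (Finset.range (m + 1)).sup fun i => (Z i).sup id :=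
        Finset.le_sup (f := fun i => (Z i).sup id) (Finset.mem_range.2 him)
      exact absurd ((le_sup_id ha).trans h₁) (hi a ha).not_ge
    · obtain ⟨k, rfl⟩ := Nat.exists_eq_add_of_le' (not_lt.1 him)
      exact inUnions_self (fun n => Z (n + (m + 1))) k
  · have := hZb.le_of_mem _ a ha
    omega

theorem CondensationStar.exists_inUnions {X Y : ℕ → Finset ℕ} (h : CondensationStar Y X) :
    ∃ m, ∀ s, InUnions Y s → (∀ b ∈ s, m < b) → InUnions X s := by
  obtain ⟨m, hm⟩ := h
  refine ⟨m, ?_⟩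
  rintro s ⟨I, hI, rfl⟩ hs
  exact InUnions.of_forall_mem hI fun i hi =>
    hm i fun a ha => hs a (Finset.mem_biUnion.2 ⟨i, hi, ha⟩)

/-- Countably many requirements, each of which can be met by condensing inside a
Matet-adequate family, can be met simultaneously up to a finite error. -/
theorem MatetAdequate.exists_fusion {H : Set (ℕ → Finset ℕ)} (hH : MatetAdequate H)
    {ι : Type*} [Nonempty ι] [Countable ι] {P : ι → (ℕ → Finset ℕ) → Prop}
    (hP : ∀ i, ∀ X ∈ H, ∃ Y ∈ H, Condensation Y X ∧ P i Y)
    {X : ℕ → Finset ℕ} (hX : X ∈ H) :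
    ∃ Y ∈ H, Condensation Y X ∧ ∀ i, ∃ Z, P i Z ∧
      ∃ m, ∀ s, InUnions Y s → (∀ b ∈ s, m < b) → InUnions Z s := by
  obtain ⟨e, he⟩ := exists_surjective_nat ι
  have hstep : ∀ (k : ℕ) (W : H), ∃ W' : H, Condensation W'.1 W.1 ∧ P (e k) W'.1 := by
    rintro k ⟨W, hW⟩
    obtain ⟨Y, hY, h⟩ := hP (e k) W hW
    exact ⟨⟨Y, hY⟩, h⟩
  choose g hg hPg using hstep
  let F : ℕ → H := fun k => Nat.rec ⟨X, hX⟩ g k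
  obtain ⟨Z, hZ, hZF⟩ := hH.2.2.2.2.1 (fun k => (F k).1) (fun k => (F k).2)
    fun k => hg k (F k)
  obtain ⟨Y, hY, hYX, hYZ⟩ := hH.exists_tail hZ (hZF 0)
  refine ⟨Y, hY, hYX, fun i => ?_⟩
  obtain ⟨k, rfl⟩ := he i
  obtain ⟨m, hm⟩ := (hZF (k + 1)).exists_inUnions
  exact ⟨(F (k + 1)).1, hPg k (F k), m, fun s hs => hm s (hs.mono hYZ)⟩

theorem MatetAdequate.exists_homogeneous {H : Set (ℕ → Finset ℕ)} (hH : MatetAdequate H)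
    (n : ℕ) : ∀ X ∈ H, ∀ c : (Fin n → Finset ℕ) → Fin 2,
      ∃ Y ∈ H, Condensation Y X ∧ ∃ j : Fin 2, ∀ a : Fin n → Finset ℕ, IsFinBlockSeq a →
        (∀ i, InUnions Y (a i)) → c a = j := by
  induction n with
  | zero =>
    intro X hX c
    exact ⟨X, hX, inUnions_self X, c Fin.elim0, fun a _ _ => congrArg c (Subsingleton.elim _ _)⟩
  | succ n ih =>
    intro X hX c
    obtain ⟨W, hW, hWX, hfusion⟩ := hH.exists_fusion
      (fun (s : Finset ℕ) X hX => ih X hX fun a => c (Fin.cons s a)) hX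
    choose Z hZ M hM using hfusion
    choose j hj using hZ
    obtain ⟨V, hV, hVW, hgap⟩ := hH.exists_gap hW
      fun k => (Finset.range (k + 1)).powerset.sup M
    obtain ⟨Y, hY, hYV, i₀, hi₀⟩ := hH.2.2.2.2.2 V hV j
    refine ⟨Y, hY, (hYV.trans hVW).trans hWX, i₀, fun a ha haY => ?_⟩
    rw [← hi₀ (a 0) (haY 0), ← Fin.cons_self_tail a]
    refine hj (a 0) (Fin.tail a) ⟨fun i => ha.1 _, fun i k hik =>
      ha.2 _ _ (Fin.succ_lt_succ_iff.2 hik)⟩ fun i => ?_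
    have haV := fun i => (haY i).mono hYV
    refine hM (a 0) _ ((haV i.succ).mono hVW) fun b hb => ?_
    refine lt_of_le_of_lt ?_ (hgap (a 0) (a i.succ) (haV 0) (haV _)
      (ha.2 _ _ (Fin.succ_pos i)) b hb)
    refine Finset.le_sup (f := M) (Finset.mem_powerset.2 fun x hx => ?_)
    exact Finset.mem_range.2 (Nat.lt_succ_of_le (le_sup_id hx))

/-- Matet-adequate families satisfy the higher-dimensional Hindman/Taylor property. -/
theorem matetAdequate_taylor (H : Set (ℕ → Finset ℕ)) (hH : MatetAdequate H)
    (n : ℕ) (hn : 0 < n) (X : ℕ → Finset ℕ) (hX : X ∈ H)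
    (c : (Fin n → Finset ℕ) → Fin 2) :
    ∃ Y ∈ H, Condensation Y X ∧
      ∃ j : Fin 2, ∀ a : Fin n → Finset ℕ, IsFinBlockSeq a →
        (∀ i, InUnions Y (a i)) → c a = j :=
  hH.exists_homogeneous n X hX c
end

section
/- Let ⟨k_i : i ∈ ℕ⟩ be a strictly increasing sequence of naturals with k_0 = 0 (so the intervals [k_i, k_{i+1}) partition ℕ). Let U0, U1 be two non-isomorphic Ramsey ultrafilters on ℕ and let W be a Q-point on ℕ that is isomorphic neither to U0 nor to U1. Then for every X ∈ FIN^[∞](⟨U0,U1⟩) there exist Y ∈ FIN^[∞](⟨U0,U1⟩) with Y ≤ X and w ∈ W such that for every i ≥ 2: if (⋃_n Y(n)) ∩ [k_{i-1}, k_i) ≠ ∅, then w ∩ [k_{i-2}, k_{i-1}) = ∅, w ∩ [k_{i-1}, k_i) = ∅, and w ∩ [k_i, k_{i+1}) = ∅. -/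
/-- A (ultra)filter is free if it contains no finite set, equivalently
every member is infinite. -/
def FreeUf {S : Type} (U : Ultrafilter S) : Prop := ∀ A ∈ U, Set.Infinite A

/-- Isomorphism of ultrafilters: some bijection maps one to the other. -/
def UfIso {S T : Type} (U : Ultrafilter S) (V : Ultrafilter T) : Prop :=
  ∃ f : S ≃ T, Ultrafilter.map f U = V

/-- A Ramsey ultrafilter on ℕ: free, and every 2-coloring of pairs has a
monochromatic member. -/
def IsRamseyUf (U : Ultrafilter ℕ) : Prop :=
  FreeUf U ∧ ∀ c : ℕ → ℕ → Fin 2, ∃ A : Set ℕ, A ∈ U ∧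
    ∃ j : Fin 2, ∀ x ∈ A, ∀ y ∈ A, x < y → c x y = j

/-- A Q-point on ℕ: free, and for every partition of ℕ into finite sets
(encoded as a finite-to-one function, whose fibers are the pieces) there is a
member meeting each piece in at most one point. -/
def IsQPointUf (U : Ultrafilter ℕ) : Prop :=
  FreeUf U ∧ ∀ f : ℕ → ℕ, (∀ m, (f ⁻¹' {m}).Finite) →
    ∃ A : Set ℕ, A ∈ U ∧ Set.InjOn f A

/-- Mildenberger's family `FIN^[∞](⟨U0,U1⟩)`. -/
def FINinfPair (U0 U1 : Ultrafilter ℕ) : Set (ℕ → Finset ℕ) :=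
  {X | IsBlockSeq X ∧ ∀ A : Set ℕ, A ∈ U0 → ∀ B : Set ℕ, B ∈ U1 →
    ∃ Y : ℕ → Finset ℕ, ∃ hY : IsBlockSeq Y, Condensation Y X ∧
      ∀ n, (Y n).min' (hY n).1 ∈ A ∧ (Y n).max' (hY n).1 ∈ B}

theorem UfIso.symm' {S T : Type} {U : Ultrafilter S} {V : Ultrafilter T} (h : UfIso U V) :
    UfIso V U := by
  obtain ⟨f, rfl⟩ := h
  exact ⟨f.symm, by rw [Ultrafilter.map_map]; simp⟩

theorem UfIso.trans' {S T R : Type} {U : Ultrafilter S} {V : Ultrafilter T} {W : Ultrafilter R}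
    (h : UfIso U V) (h' : UfIso V W) : UfIso U W := by
  obtain ⟨f, rfl⟩ := h
  obtain ⟨g, rfl⟩ := h'
  exact ⟨f.trans g, by rw [Ultrafilter.map_map]; rfl⟩

/-- An infinite member of an ultrafilter on `ℕ` has a subset in the ultrafilter
with infinite relative complement. -/
theorem exists_mem_subset_sdiff_infinite (U : Ultrafilter ℕ) {A : Set ℕ} (hA : A ∈ U)
    (hinf : A.Infinite) : ∃ B ∈ U, B ⊆ A ∧ (A \ B).Infinite := by
  have hmono := Nat.nth_strictMono (p := (· ∈ A)) hinf
  have hmem := Nat.nth_mem_of_infinite (p := (· ∈ A)) hinf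
  set a := Nat.nth (· ∈ A)
  rcases U.mem_or_compl_mem (Set.range fun n => a (2 * n)) with h | h
  · refine ⟨A ∩ _, Filter.inter_mem hA h, Set.inter_subset_left, ?_⟩
    refine (Set.infinite_range_of_injective (f := fun n => a (2 * n + 1)) ?_).mono ?_
    · intro x y hxy
      have := hmono.injective hxy
      omega
    · rintro _ ⟨n, rfl⟩
      refine ⟨hmem _, ?_⟩
      rintro ⟨-, m, hm⟩
      have := hmono.injective hm
      omega
  · refine ⟨A ∩ _, Filter.inter_mem hA h, Set.inter_subset_left, ?_⟩
    refine (Set.infinite_range_of_injective (f := fun n => a (2 * n)) ?_).mono ?_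
    · intro x y hxy
      have := hmono.injective hxy
      omega
    · rintro _ ⟨n, rfl⟩
      exact ⟨hmem _, fun h => h.2 ⟨n, rfl⟩⟩

/-- A map injective on a member of a free ultrafilter induces an isomorphism onto its image. -/
theorem FreeUf.ufIso_map {U : Ultrafilter ℕ} (hU : FreeUf U) {f : ℕ → ℕ} {A : Set ℕ}
    (hA : A ∈ U) (hf : Set.InjOn f A) : UfIso U (U.map f) := by
  classical
  obtain ⟨B, hB, hBA, hinf⟩ := exists_mem_subset_sdiff_infinite U hA (hU A hA)
  have h1 : (Bᶜ).Infinite := hinf.mono fun x hx => hx.2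
  have h2 : ((f '' B)ᶜ).Infinite := by
    refine (hinf.image (hf.mono Set.sdiff_subset)).mono ?_
    rintro _ ⟨x, hx, rfl⟩ ⟨y, hy, hxy⟩
    exact hx.2 (hf (hBA hy) hx.1 hxy ▸ hy)
  have := h1.to_subtype
  have := h2.to_subtype
  obtain ⟨d⟩ := nonempty_equiv_of_countable (α := (Bᶜ : Set ℕ)) (β := ((f '' B)ᶜ : Set ℕ))
  let e := Equiv.Set.imageOfInjOn f B (hf.mono hBA)
  let g : ℕ ≃ ℕ := (Equiv.Set.sumCompl B).symm.trans
    ((Equiv.sumCongr e d).trans (Equiv.Set.sumCompl (f '' B)))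
  have hg : ∀ x ∈ B, g x = f x := by
    intro x hx
    simp only [g, Equiv.trans_apply, Equiv.Set.sumCompl_symm_apply_of_mem hx]
    rfl
  refine ⟨g, ?_⟩
  apply Ultrafilter.coe_injective
  rw [Ultrafilter.coe_map, Ultrafilter.coe_map]
  exact Filter.map_congr (Filter.mem_of_superset hB hg)

theorem ufIso_of_map_eq {U V : Ultrafilter ℕ} (hU : FreeUf U) (hV : FreeUf V) {f g : ℕ → ℕ}
    {A B : Set ℕ} (hA : A ∈ U) (hB : B ∈ V) (hf : Set.InjOn f A) (hg : Set.InjOn g B)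
    (h : U.map f = V.map g) : UfIso U V := by
  have h1 := hU.ufIso_map hA hf
  rw [h] at h1
  exact h1.trans' (hV.ufIso_map hB hg).symm'

theorem IsRamseyUf.isQPointUf {U : Ultrafilter ℕ} (hU : IsRamseyUf U) : IsQPointUf U := by
  classical
  refine ⟨hU.1, fun f hf => ?_⟩
  obtain ⟨A, hA, j, hj⟩ := hU.2 fun x y => if f x = f y then 0 else 1
  refine ⟨A, hA, ?_⟩
  fin_cases j
  · exfalso
    obtain ⟨x, hx⟩ := (hU.1 A hA).nonempty
    refine hU.1 A hA (((hf (f x)).union (Set.finite_Iic x)).subset fun y hy => ?_)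
    rcases le_or_gt y x with h | h
    · exact Or.inr h
    · left
      have := hj x hx y hy h
      simp only [Fin.zero_eta, ite_eq_left_iff, one_ne_zero, imp_false, not_not] at this
      exact this.symm
  · intro x hx y hy hxy
    by_contra hne
    rcases lt_or_gt_of_ne hne with h | h
    · have := hj x hx y hy h
      simp [hxy] at this
    · have := hj y hy x hx h
      simp [hxy] at this

theorem IsRamseyUf.of_map {V : Ultrafilter ℕ} {u : ℕ → ℕ} (hu : StrictMono u)
    (h : IsRamseyUf (V.map u)) : IsRamseyUf V := by
  refine ⟨fun A hA => ?_, fun c => ?_⟩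
  · refine Set.Infinite.of_image u (h.1 _ (Ultrafilter.mem_map.2 ?_))
    exact Filter.mem_of_superset hA (Set.subset_preimage_image u A)
  · obtain ⟨A, hA, j, hj⟩ := h.2 fun x y => c (Function.invFun u x) (Function.invFun u y)
    refine ⟨u ⁻¹' A, hA, j, fun x hx y hy hxy => ?_⟩
    have := hj (u x) hx (u y) hy (hu hxy)
    simpa only [Function.leftInverse_invFun hu.injective _] using this

/-- Index of the interval of the partition cut out by `s` that contains `x`. -/
noncomputable def cutIndex (s : ℕ → ℕ) (x : ℕ) : ℕ := sInf {k | x < s k}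

theorem lt_cutIndex {s : ℕ → ℕ} (hs : StrictMono s) (x : ℕ) : x < s (cutIndex s x) :=
  Nat.sInf_mem (s := {k | x < s k}) ⟨x + 1, lt_of_lt_of_le (Nat.lt_succ_self x) hs.le_apply⟩

theorem cutIndex_le {s : ℕ → ℕ} {x k : ℕ} (h : x < s k) : cutIndex s x ≤ k :=
  Nat.sInf_le h

theorem cutIndex_eq {s : ℕ → ℕ} (hs : StrictMono s) {x n : ℕ} (h1 : s n ≤ x)
    (h2 : x < s (n + 1)) : cutIndex s x = n + 1 := by
  refine le_antisymm (cutIndex_le h2) ?_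
  exact hs.lt_iff_lt.1 (h1.trans_lt (lt_cutIndex hs x))

theorem IsQPointUf.exists_injOn_cutIndex {U : Ultrafilter ℕ} (hU : IsQPointUf U) {s : ℕ → ℕ}
    (hs : StrictMono s) : ∃ A ∈ U, Set.InjOn (cutIndex s) A := by
  refine hU.2 (cutIndex s) fun m => (Set.finite_Iio (s m)).subset ?_
  rintro x rfl
  exact lt_cutIndex hs x

theorem exists_mem_compl_mem_of_ne {S : Type} {U V : Ultrafilter S} (h : U ≠ V) :
    ∃ A ∈ U, Aᶜ ∈ V := by
  by_contra! hc
  refine h (Ultrafilter.eq_of_le fun A hA => ?_).symm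
  exact Ultrafilter.compl_notMem_iff.1 (hc A hA)

/-- Non-isomorphic Q-points have members unrelated by a given locally finite relation. -/
theorem exists_mem_unrelated {U V : Ultrafilter ℕ} (hU : IsQPointUf U) (hV : IsQPointUf V)
    (hUV : ¬ UfIso U V) (R : ℕ → ℕ → Prop) (hR1 : ∀ x, {y | R x y}.Finite)
    (hR2 : ∀ y, {x | R x y}.Finite) :
    ∃ A ∈ U, ∃ B ∈ V, ∀ x ∈ A, ∀ y ∈ B, ¬ R x y := by
  have hbound : ∀ N, ∃ M, N < M ∧ ∀ x y, R x y → (x < N → y < M) ∧ (y < N → x < M) := by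
    intro N
    have h1 : (⋃ x ∈ Set.Iio N, {y | R x y}).Finite := (Set.finite_Iio N).biUnion fun x _ => hR1 x
    have h2 : (⋃ y ∈ Set.Iio N, {x | R x y}).Finite := (Set.finite_Iio N).biUnion fun y _ => hR2 y
    obtain ⟨b1, hb1⟩ := h1.bddAbove
    obtain ⟨b2, hb2⟩ := h2.bddAbove
    refine ⟨N + b1 + b2 + 1, by omega, fun x y hxy => ⟨fun hx => ?_, fun hy => ?_⟩⟩
    · have : y ≤ b1 := hb1 (Set.mem_biUnion (x := x) hx hxy)
      omega
    · have : x ≤ b2 := hb2 (Set.mem_biUnion (x := y) hy hxy)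
      omega
  choose F hF hFR using hbound
  let p : ℕ → ℕ := fun n => F^[n] 0
  have hps : ∀ n, p (n + 1) = F (p n) := fun n => Function.iterate_succ_apply' F n 0
  have hp : StrictMono p := strictMono_nat_of_lt_succ fun n => by rw [hps]; exact hF _
  obtain ⟨A, hA, hAi⟩ := hU.exists_injOn_cutIndex hp
  obtain ⟨B, hB, hBi⟩ := hV.exists_injOn_cutIndex hp
  have hsep : ∀ c d : ℕ, ∃ S ∈ U, ∃ T ∈ V, ∀ x ∈ S, ∀ y ∈ T,
      cutIndex p x + c ≠ cutIndex p y + d := by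
    intro c d
    have hne : U.map (fun x => cutIndex p x + c) ≠ V.map (fun y => cutIndex p y + d) := by
      intro heq
      refine hUV (ufIso_of_map_eq hU.1 hV.1 hA hB ?_ ?_ heq)
      · exact fun x hx y hy h => hAi hx hy (Nat.add_right_cancel h)
      · exact fun x hx y hy h => hBi hx hy (Nat.add_right_cancel h)
    obtain ⟨S, hS, hT⟩ := exists_mem_compl_mem_of_ne hne
    exact ⟨_, hS, _, hT, fun x hx y hy h => hy (h ▸ hx : cutIndex p y + d ∈ S)⟩
  obtain ⟨S0, hS0, T0, hT0, h0⟩ := hsep 0 0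
  obtain ⟨S1, hS1, T1, hT1, h1⟩ := hsep 1 0
  obtain ⟨S2, hS2, T2, hT2, h2⟩ := hsep 0 1
  refine ⟨S0 ∩ S1 ∩ S2, Filter.inter_mem (Filter.inter_mem hS0 hS1) hS2,
    T0 ∩ T1 ∩ T2, Filter.inter_mem (Filter.inter_mem hT0 hT1) hT2, ?_⟩
  rintro x ⟨⟨hx0, hx1⟩, hx2⟩ y ⟨⟨hy0, hy1⟩, hy2⟩ hxy
  have e0 := h0 x hx0 y hy0
  have e1 := h1 x hx1 y hy1
  have e2 := h2 x hx2 y hy2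
  have l1 : cutIndex p y ≤ cutIndex p x + 1 :=
    cutIndex_le (by rw [hps]; exact (hFR _ x y hxy).1 (lt_cutIndex hp x))
  have l2 : cutIndex p x ≤ cutIndex p y + 1 :=
    cutIndex_le (by rw [hps]; exact (hFR _ x y hxy).2 (lt_cutIndex hp y))
  omega

/-- Starting in `S`, jump alternately to the next element of `T` and the next element of `S`. -/
theorem exists_alternating {S T : Set ℕ} (hS : S.Infinite) (hT : T.Infinite) :
    ∃ s t : ℕ → ℕ, (∀ n, s n ∈ S ∧ t n ∈ T ∧ s n < t n ∧ t n < s (n + 1)) ∧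
      (∀ n, ∀ y ∈ T, s n < y → t n ≤ y) ∧ ∀ n, ∀ x ∈ S, t n < x → s (n + 1) ≤ x := by
  have next : ∀ P : Set ℕ, P.Infinite → ∀ x, ∃ y ∈ P, x < y ∧ ∀ z ∈ P, x < z → y ≤ z := by
    intro P hP x
    obtain ⟨z, hz, hxz⟩ := hP.exists_gt x
    have hne : {y | y ∈ P ∧ x < y}.Nonempty := ⟨z, hz, hxz⟩
    exact ⟨_, (Nat.sInf_mem hne).1, (Nat.sInf_mem hne).2, fun z h1 h2 => Nat.sInf_le ⟨h1, h2⟩⟩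
  choose f hf1 hf2 hf3 using next S hS
  choose g hg1 hg2 hg3 using next T hT
  let s : ℕ → ℕ := fun n => (fun x => f (g x))^[n] (f 0)
  have hs : ∀ n, s (n + 1) = f (g (s n)) := fun n => Function.iterate_succ_apply' _ n _
  refine ⟨s, fun n => g (s n), fun n => ⟨?_, hg1 _, hg2 _, ?_⟩, fun n => hg3 _, fun n => ?_⟩
  · cases n with
    | zero => exact hf1 0
    | succ n => rw [hs]; exact hf1 _
  · rw [hs]; exact hf2 _
  · rw [hs]; exact hf3 _

/-- Distinct Q-points have strictly alternating members inside given members. -/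
theorem exists_alternating_mem {U V : Ultrafilter ℕ} (hU : IsQPointUf U) (hV : IsQPointUf V)
    (hUV : U ≠ V) {A B : Set ℕ} (hA : A ∈ U) (hB : B ∈ V) :
    ∃ a b : ℕ → ℕ, (∀ n, a n ∈ A ∧ b n ∈ B ∧ a n < b n ∧ b n < a (n + 1)) ∧
      Set.range a ∈ U ∧ Set.range b ∈ V := by
  obtain ⟨D, hDU, hDV⟩ := exists_mem_compl_mem_of_ne hUV
  have hS : A ∩ D ∈ U := Filter.inter_mem hA hDU
  have hT : B ∩ Dᶜ ∈ V := Filter.inter_mem hB hDV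
  obtain ⟨s, t, hst, hnt, hns⟩ := exists_alternating (hU.1 _ hS) (hV.1 _ hT)
  have hs : StrictMono s := strictMono_nat_of_lt_succ fun n => (hst n).2.2.1.trans (hst n).2.2.2
  obtain ⟨P, hP, hPi⟩ := hU.exists_injOn_cutIndex hs
  obtain ⟨Q, hQ, hQi⟩ := hV.exists_injOn_cutIndex hs
  have ha : ∀ n, ∃ a, s n ≤ a ∧ a < t n ∧ a ∈ A ∧
      ∀ x ∈ P ∩ (A ∩ D), s n ≤ x → x < t n → x = a := by
    intro n
    by_cases h : ∃ x ∈ P ∩ (A ∩ D), s n ≤ x ∧ x < t n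
    · obtain ⟨x, hx, h1, h2⟩ := h
      refine ⟨x, h1, h2, hx.2.1, fun y hy h3 h4 => hPi hy.1 hx.1 ?_⟩
      rw [cutIndex_eq hs h3 (h4.trans (hst n).2.2.2), cutIndex_eq hs h1 (h2.trans (hst n).2.2.2)]
    · exact ⟨s n, le_rfl, (hst n).2.2.1, (hst n).1.1, fun x hx h1 h2 => (h ⟨x, hx, h1, h2⟩).elim⟩
  have hb : ∀ n, ∃ b, t n ≤ b ∧ b < s (n + 1) ∧ b ∈ B ∧
      ∀ x ∈ Q ∩ (B ∩ Dᶜ), t n ≤ x → x < s (n + 1) → x = b := by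
    intro n
    by_cases h : ∃ x ∈ Q ∩ (B ∩ Dᶜ), t n ≤ x ∧ x < s (n + 1)
    · obtain ⟨x, hx, h1, h2⟩ := h
      refine ⟨x, h1, h2, hx.2.1, fun y hy h3 h4 => hQi hy.1 hx.1 ?_⟩
      rw [cutIndex_eq hs ((hst n).2.2.1.le.trans h3) h4,
        cutIndex_eq hs ((hst n).2.2.1.le.trans h1) h2]
    · exact ⟨t n, le_rfl, (hst n).2.2.2, (hst n).2.1.1, fun x hx h1 h2 => (h ⟨x, hx, h1, h2⟩).elim⟩
  choose a ha1 ha2 ha3 ha4 using ha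
  choose b hb1 hb2 hb3 hb4 using hb
  have hlarge : ∀ W : Ultrafilter ℕ, FreeUf W → {x | s 0 ≤ x} ∈ W := by
    intro W hW
    by_contra hc
    rw [← Ultrafilter.compl_mem_iff_notMem] at hc
    refine hW _ hc ((Set.finite_Iio (s 0)).subset fun x hx => ?_)
    simpa using hx
  have hcover : ∀ x, s 0 ≤ x → ∃ n, s n ≤ x ∧ x < s (n + 1) := by
    intro x hx
    have h1 := lt_cutIndex hs x
    obtain ⟨n, hn⟩ : ∃ n, cutIndex s x = n + 1 := by
      refine Nat.exists_eq_succ_of_ne_zero fun h => ?_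
      rw [h] at h1
      omega
    rw [hn] at h1
    refine ⟨n, ?_, h1⟩
    by_contra hc
    have := cutIndex_le (s := s) (not_le.1 hc)
    omega
  refine ⟨a, b, fun n => ⟨ha3 n, hb3 n, (ha2 n).trans_le (hb1 n), (hb2 n).trans_le (ha1 _)⟩, ?_, ?_⟩
  · refine Filter.mem_of_superset (Filter.inter_mem (Filter.inter_mem hP hS) (hlarge U hU.1)) ?_
    rintro x ⟨hx, hx0⟩
    obtain ⟨n, h1, h2⟩ := hcover x hx0
    refine ⟨n, (ha4 n x hx h1 ?_).symm⟩
    rcases lt_trichotomy x (t n) with h | h | h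
    · exact h
    · exact ((hst n).2.1.2 (h ▸ hx.2.2)).elim
    · exact absurd (hns n x hx.2 h) (not_le.2 h2)
  · refine Filter.mem_of_superset (Filter.inter_mem (Filter.inter_mem hQ hT) (hlarge V hV.1)) ?_
    rintro x ⟨hx, hx0⟩
    obtain ⟨n, h1, h2⟩ := hcover x hx0
    refine ⟨n, (hb4 n x hx ?_ h2).symm⟩
    rcases h1.eq_or_lt with h | h
    · exact (hx.2.2 (h ▸ (hst n).1.2)).elim
    · exact hnt n x hx.2 h

theorem IsBlockSeq.blockLt {X : ℕ → Finset ℕ} (hX : IsBlockSeq X) {i j : ℕ} (hij : i < j) :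
    blockLt (X i) (X j) := by
  induction j, hij using Nat.le_induction with
  | base => exact (hX i).2
  | succ j _ ih =>
    intro x hx y hy
    obtain ⟨z, hz⟩ := (hX j).1
    exact (ih x hx z hz).trans ((hX j).2 z hz y hy)

theorem IsBlockSeq.strictMono_min' {X : ℕ → Finset ℕ} (hX : IsBlockSeq X) :
    StrictMono fun n => (X n).min' (hX n).1 :=
  fun _ _ hij => hX.blockLt hij _ (Finset.min'_mem _ _) _ (Finset.min'_mem _ _)

theorem IsBlockSeq.strictMono_max' {X : ℕ → Finset ℕ} (hX : IsBlockSeq X) :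
    StrictMono fun n => (X n).max' (hX n).1 :=
  fun _ _ hij => hX.blockLt hij _ (Finset.max'_mem _ _) _ (Finset.max'_mem _ _)

/-- Merging blocks in pairs along alternating indices. -/
theorem IsBlockSeq.union_pairs {X : ℕ → Finset ℕ} (hX : IsBlockSeq X) {a b : ℕ → ℕ}
    (hab : ∀ n, a n < b n) (hba : ∀ n, b n < a (n + 1)) :
    ∃ hY : IsBlockSeq fun n => X (a n) ∪ X (b n),
      Condensation (fun n => X (a n) ∪ X (b n)) X ∧
      ∀ n, (X (a n) ∪ X (b n)).min' (hY n).1 = (X (a n)).min' (hX _).1 ∧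
        (X (a n) ∪ X (b n)).max' (hY n).1 = (X (b n)).max' (hX _).1 := by
  have hY : IsBlockSeq fun n => X (a n) ∪ X (b n) := by
    intro n
    refine ⟨(hX (a n)).1.mono Finset.subset_union_left, fun x hx y hy => ?_⟩
    have h1 := hab n
    have h2 := hba n
    have h3 := hab (n + 1)
    rcases Finset.mem_union.1 hx with hx | hx <;> rcases Finset.mem_union.1 hy with hy | hy <;>
      exact hX.blockLt (by omega) x hx y hy
  refine ⟨hY, fun n => ⟨{a n, b n}, by simp, by simp⟩, fun n => ⟨?_, ?_⟩⟩
  · refine le_antisymm (Finset.min'_le _ _ (Finset.mem_union_left _ (Finset.min'_mem _ _))) ?_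
    refine Finset.le_min' _ _ _ fun y hy => ?_
    rcases Finset.mem_union.1 hy with hy | hy
    · exact Finset.min'_le _ _ hy
    · exact (hX.blockLt (hab n) _ (Finset.min'_mem _ _) y hy).le
  · refine le_antisymm ?_ (Finset.le_max' _ _ (Finset.mem_union_right _ (Finset.max'_mem _ _)))
    refine Finset.max'_le _ _ _ fun y hy => ?_
    rcases Finset.mem_union.1 hy with hy | hy
    · exact (hX.blockLt (hab n) y hy _ (Finset.max'_mem _ _)).le
    · exact Finset.le_max' _ _ hy

theorem IsBlockSeq.mem_FINinfPair {U0 U1 : Ultrafilter ℕ} (h0 : FreeUf U0) (h1 : FreeUf U1)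
    {Y : ℕ → Finset ℕ} (hY : IsBlockSeq Y)
    (hmin : (Set.range fun n => (Y n).min' (hY n).1) ∈ U0)
    (hmax : (Set.range fun n => (Y n).max' (hY n).1) ∈ U1) : Y ∈ FINinfPair U0 U1 := by
  refine ⟨hY, fun A hA B hB => ?_⟩
  have hS : {n | (Y n).min' (hY n).1 ∈ A}.Infinite := by
    refine Set.Infinite.of_image (fun n => (Y n).min' (hY n).1)
      ((h0 _ (Filter.inter_mem hA hmin)).mono ?_)
    rintro _ ⟨hx, n, rfl⟩
    exact ⟨n, hx, rfl⟩
  have hT : {n | (Y n).max' (hY n).1 ∈ B}.Infinite := by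
    refine Set.Infinite.of_image (fun n => (Y n).max' (hY n).1)
      ((h1 _ (Filter.inter_mem hB hmax)).mono ?_)
    rintro _ ⟨hx, n, rfl⟩
    exact ⟨n, hx, rfl⟩
  obtain ⟨s, t, hst, -⟩ := exists_alternating hS hT
  obtain ⟨hZ, hZY, hZm⟩ := hY.union_pairs (fun n => (hst n).2.2.1) (fun n => (hst n).2.2.2)
  exact ⟨_, hZ, hZY, fun n => ⟨by rw [(hZm n).1]; exact (hst n).1,
    by rw [(hZm n).2]; exact (hst n).2.1⟩⟩

theorem InUnions.exists_min'_eq {X : ℕ → Finset ℕ} (hX : IsBlockSeq X) {s : Finset ℕ}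
    (hs : InUnions X s) (hne : s.Nonempty) : ∃ n, (X n).min' (hX n).1 = s.min' hne := by
  obtain ⟨I, -, rfl⟩ := hs
  obtain ⟨i, hi, hm⟩ := Finset.mem_biUnion.1 (Finset.min'_mem _ hne)
  exact ⟨i, le_antisymm (Finset.min'_le _ _ hm)
    (Finset.min'_le _ _ (Finset.mem_biUnion.2 ⟨i, hi, Finset.min'_mem _ _⟩))⟩

theorem InUnions.exists_max'_eq {X : ℕ → Finset ℕ} (hX : IsBlockSeq X) {s : Finset ℕ}
    (hs : InUnions X s) (hne : s.Nonempty) : ∃ n, (X n).max' (hX n).1 = s.max' hne := by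
  obtain ⟨I, -, rfl⟩ := hs
  obtain ⟨i, hi, hm⟩ := Finset.mem_biUnion.1 (Finset.max'_mem _ hne)
  exact ⟨i, le_antisymm
    (Finset.le_max' _ _ (Finset.mem_biUnion.2 ⟨i, hi, Finset.max'_mem _ _⟩)) (Finset.le_max' _ _ hm)⟩

theorem range_min'_mem_of_mem_FINinfPair {U0 U1 : Ultrafilter ℕ} {X : ℕ → Finset ℕ}
    (hX : X ∈ FINinfPair U0 U1) : (Set.range fun n => (X n).min' (hX.1 n).1) ∈ U0 := by
  by_contra hc
  obtain ⟨Y, hY, hYX, h⟩ := hX.2 _ (Ultrafilter.compl_mem_iff_notMem.2 hc) _ Filter.univ_mem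
  exact (h 0).1 ((hYX 0).exists_min'_eq hX.1 _)

theorem range_max'_mem_of_mem_FINinfPair {U0 U1 : Ultrafilter ℕ} {X : ℕ → Finset ℕ}
    (hX : X ∈ FINinfPair U0 U1) : (Set.range fun n => (X n).max' (hX.1 n).1) ∈ U1 := by
  by_contra hc
  obtain ⟨Y, hY, hYX, h⟩ := hX.2 _ Filter.univ_mem _ (Ultrafilter.compl_mem_iff_notMem.2 hc)
  exact (h 0).2 ((hYX 0).exists_max'_eq hX.1 _)

theorem exists_map_eq_of_range_mem {U : Ultrafilter ℕ} {u : ℕ → ℕ} (hu : Function.Injective u)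
    (h : Set.range u ∈ U) : ∃ V : Ultrafilter ℕ, V.map u = U := by
  refine ⟨U.comap hu h, Ultrafilter.coe_injective ?_⟩
  rw [Ultrafilter.coe_map, Ultrafilter.coe_comap]
  exact Filter.map_comap_of_mem h

/-- Lemma on avoiding adjacent intervals: given an interval partition, a
Q-point `W` not isomorphic to `U0` or `U1`, and `X ∈ FIN^[∞](⟨U0,U1⟩)`,
there are `Y ≤ X` in the family and `w ∈ W` such that whenever `⋃ Y` meets
`[k_{i-1}, k_i)`, the set `w` avoids that interval and both adjacent ones. -/
theorem avoid_adjacent_intervals (K : ℕ → ℕ) (hK : StrictMono K) (hK0 : K 0 = 0)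
    (U0 U1 : Ultrafilter ℕ) (h0 : IsRamseyUf U0) (h1 : IsRamseyUf U1)
    (hne : ¬ UfIso U0 U1)
    (W : Ultrafilter ℕ) (hW : IsQPointUf W)
    (hW0 : ¬ UfIso W U0) (hW1 : ¬ UfIso W U1)
    (X : ℕ → Finset ℕ) (hX : X ∈ FINinfPair U0 U1) :
    ∃ Y ∈ FINinfPair U0 U1, Condensation Y X ∧
      ∃ w : Set ℕ, w ∈ W ∧
        ∀ i : ℕ, 2 ≤ i → (∃ nn : ℕ, ∃ m ∈ Y nn, m ∈ Set.Ico (K (i - 1)) (K i)) →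
          w ∩ Set.Ico (K (i - 2)) (K (i - 1)) = ∅ ∧
          w ∩ Set.Ico (K (i - 1)) (K i) = ∅ ∧
          w ∩ Set.Ico (K i) (K (i + 1)) = ∅ := by
  have hXb := hX.1
  have hmin := hXb.strictMono_min'
  have hmax := hXb.strictMono_max'
  obtain ⟨V0, hV0⟩ := exists_map_eq_of_range_mem hmin.injective
    (range_min'_mem_of_mem_FINinfPair hX)
  obtain ⟨V1, hV1⟩ := exists_map_eq_of_range_mem hmax.injective
    (range_max'_mem_of_mem_FINinfPair hX)
  have hR0 : IsRamseyUf V0 := IsRamseyUf.of_map hmin (hV0.symm ▸ h0)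
  have hR1 : IsRamseyUf V1 := IsRamseyUf.of_map hmax (hV1.symm ▸ h1)
  have hi0 : UfIso V0 U0 := by
    have := hR0.1.ufIso_map Filter.univ_mem hmin.injective.injOn
    rwa [hV0] at this
  have hi1 : UfIso V1 U1 := by
    have := hR1.1.ufIso_map Filter.univ_mem hmax.injective.injOn
    rwa [hV1] at this
  have hV : V0 ≠ V1 := by
    rintro rfl
    exact hne (hi0.symm'.trans' hi1)
  -- `y` lies within one interval of an interval met by the block `X n`
  let R : ℕ → ℕ → Prop := fun n y => ∃ m ∈ X n, ∃ i, 2 ≤ i ∧ m ∈ Set.Ico (K (i - 1)) (K i) ∧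
    y ∈ Set.Ico (K (i - 2)) (K (i + 1))
  have hf1 : ∀ n, {y | R n y}.Finite := by
    intro n
    refine ((X n).finite_toSet.biUnion fun m _ => Set.finite_Iio (K (m + 2))).subset ?_
    rintro y ⟨m, hm, i, hi, hmi, hy⟩
    refine Set.mem_biUnion (x := m) hm (hy.2.trans_le (hK.monotone ?_))
    have : i - 1 ≤ m := hK.le_apply.trans hmi.1
    omega
  have hf2 : ∀ y, {n | R n y}.Finite := by
    intro y
    refine (Set.finite_Iio (K (y + 2))).subset ?_
    rintro n ⟨m, hm, i, hi, hmi, hy⟩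
    have h3 : i - 2 ≤ y := hK.le_apply.trans hy.1
    have h4 : K i ≤ K (y + 2) := hK.monotone (by omega)
    have h5 : n ≤ (X n).min' (hXb n).1 := hmin.le_apply
    have h6 : (X n).min' (hXb n).1 ≤ m := Finset.min'_le _ _ hm
    exact lt_of_le_of_lt (h5.trans h6) (hmi.2.trans_le h4)
  obtain ⟨A, hA, w0, hw0, hAw⟩ := exists_mem_unrelated hR0.isQPointUf hW
    (fun h => hW0 (h.symm'.trans' hi0)) R hf1 hf2
  obtain ⟨B, hB, w1, hw1, hBw⟩ := exists_mem_unrelated hR1.isQPointUf hW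
    (fun h => hW1 (h.symm'.trans' hi1)) R hf1 hf2
  obtain ⟨a, b, hab, hra, hrb⟩ :=
    exists_alternating_mem hR0.isQPointUf hR1.isQPointUf hV hA hB
  obtain ⟨hY, hYX, hYm⟩ := hXb.union_pairs (fun n => (hab n).2.2.1) (fun n => (hab n).2.2.2)
  refine ⟨_, hY.mem_FINinfPair h0.1 h1.1 ?_ ?_, hYX, w0 ∩ w1, Filter.inter_mem hw0 hw1, ?_⟩
  · rw [← hV0, Ultrafilter.mem_map]
    refine Filter.mem_of_superset hra ?_
    rintro _ ⟨n, rfl⟩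
    exact ⟨n, (hYm n).1⟩
  · rw [← hV1, Ultrafilter.mem_map]
    refine Filter.mem_of_superset hrb ?_
    rintro _ ⟨n, rfl⟩
    exact ⟨n, (hYm n).2⟩
  · rintro i hi ⟨n, m, hm, hmi⟩
    have key : ∀ y ∈ w0 ∩ w1, y ∉ Set.Ico (K (i - 2)) (K (i + 1)) := by
      intro y hy hyi
      rcases Finset.mem_union.1 hm with hm | hm
      · exact hAw _ (hab n).1 y hy.1 ⟨m, hm, i, hi, hmi, hyi⟩
      · exact hBw _ (hab n).2.1 y hy.2 ⟨m, hm, i, hi, hmi, hyi⟩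
    have k1 : K (i - 2) ≤ K (i - 1) := hK.monotone (by omega)
    have k2 : K (i - 1) ≤ K i := hK.monotone (by omega)
    have k3 : K i ≤ K (i + 1) := hK.monotone (by omega)
    refine ⟨?_, ?_, ?_⟩ <;> refine Set.eq_empty_of_forall_notMem fun y hy => key y hy.1 ?_
    · exact ⟨hy.2.1, hy.2.2.trans_le (k2.trans k3)⟩
    · exact ⟨k1.trans hy.2.1, hy.2.2.trans_le k3⟩
    · exact ⟨(k1.trans k2).trans hy.2.1, hy.2.2⟩
end
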